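/- Let c₁ > 0. There exists a constant C > 0 depending only on c₁ with the following property: for every R > 1, every ε > 0, and every twice continuously differentiable function g on [0,R) with g(0) = 0, g'(0) = 0, satisfying g''(r) + (1/r)g'(r) + (8c₁/(1 + c₁r²)²)·g(r) = E(r) for all 0 < r < R, where E is continuous and |E(r)| ≤ ε(1 + r)^{−3} for 0 < r < R, one has |g(r)| ≤ C·ε·log(2 + r) for all 0 ≤ r < R. -/

import Mathlib

open Real

/-- A function vanishing at the left endpoint is bounded by the increment of any function whose
derivative dominates its own. -/
lemma abs_le_sub_of_abs_deriv_le {R : ℝ} {W W' B B' : ℝ → ℝ}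
    (hW : ContinuousOn W (Set.Ico 0 R)) (hB : ContinuousOn B (Set.Ico 0 R))
    (hW' : ∀ r ∈ Set.Ioo 0 R, HasDerivAt W (W' r) r)
    (hB' : ∀ r ∈ Set.Ioo 0 R, HasDerivAt B (B' r) r)
    (h0 : W 0 = 0) (hle : ∀ r ∈ Set.Ioo 0 R, |W' r| ≤ B' r)
    {r : ℝ} (hr : r ∈ Set.Ico 0 R) : |W r| ≤ B r - B 0 := by
  have h0R : (0 : ℝ) ∈ Set.Ico 0 R := ⟨le_rfl, hr.1.trans_lt hr.2⟩
  have hsub : MonotoneOn (fun x => B x - W x) (Set.Ico 0 R) := by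
    apply monotoneOn_of_deriv_nonneg (convex_Ico 0 R) (hB.sub hW) <;> rw [interior_Ico]
    · exact fun x hx => ((hB' x hx).sub (hW' x hx)).differentiableAt.differentiableWithinAt
    · intro x hx
      have hd : deriv (B - W) x = B' x - W' x := ((hB' x hx).sub (hW' x hx)).deriv
      rw [hd]
      linarith [(abs_le.1 (hle x hx)).2]
  have hadd : MonotoneOn (fun x => B x + W x) (Set.Ico 0 R) := by
    apply monotoneOn_of_deriv_nonneg (convex_Ico 0 R) (hB.add hW) <;> rw [interior_Ico]
    · exact fun x hx => ((hB' x hx).add (hW' x hx)).differentiableAt.differentiableWithinAt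
    · intro x hx
      have hd : deriv (B + W) x = B' x + W' x := ((hB' x hx).add (hW' x hx)).deriv
      rw [hd]
      linarith [(abs_le.1 (hle x hx)).1]
  have h1 := hsub h0R hr hr.1
  have h2 := hadd h0R hr hr.1
  simp only [h0] at h1 h2
  exact abs_le.2 ⟨by linarith, by linarith⟩

/-- Lagrange's identity for the radial operator `φ'' + φ' / r + V φ`, where `d = g'` and
`ψ = r φ'`. -/
lemma hasDerivAt_radial_wronskian {g d φ ψ : ℝ → ℝ} {r V e E : ℝ} (hr : r ≠ 0)
    (hg : HasDerivAt g (d r) r) (hd : HasDerivAt d e r)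
    (hode : e + 1 / r * d r + V * g r = E)
    (hφ : HasDerivAt φ (ψ r / r) r) (hψ : HasDerivAt ψ (-(r * V * φ r)) r) :
    HasDerivAt (fun x => x * d x * φ x - g x * ψ x) (r * φ r * E) r := by
  have h := (((hasDerivAt_id r).mul hd).mul hφ).sub (hg.mul hψ)
  refine h.congr_deriv ?_
  simp only [id, Pi.mul_apply]
  rw [← hode]
  field_simp
  ring

/-- The bounded radial element of the kernel of the linearized Liouville operator. -/
noncomputable def liouvilleKernel (c r : ℝ) : ℝ := 2 / (1 + c * r ^ 2) - 1

/-- `r φ'` for `φ` the bounded radial kernel element. -/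
noncomputable def liouvilleKernelFlux (c r : ℝ) : ℝ := -(4 * c * r ^ 2) / (1 + c * r ^ 2) ^ 2

/-- The logarithmically growing radial element of the kernel. -/
noncomputable def liouvilleLogKernel (c r : ℝ) : ℝ :=
  liouvilleKernel c r * log r + 2 / (1 + c * r ^ 2)

/-- `r φ'` for `φ` the logarithmic radial kernel element. -/
noncomputable def liouvilleLogKernelFlux (c r : ℝ) : ℝ :=
  liouvilleKernel c r + liouvilleKernelFlux c r * log r + liouvilleKernelFlux c r

section Kernel

variable {c : ℝ}

lemma hasDerivAt_two_div (hc : 0 < c) {r : ℝ} (hr : r ≠ 0) :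
    HasDerivAt (fun x => 2 / (1 + c * x ^ 2)) (liouvilleKernelFlux c r / r) r := by
  have hq : 1 + c * r ^ 2 ≠ 0 := by positivity
  have h := (hasDerivAt_const r (2 : ℝ)).div
    ((((hasDerivAt_id r).pow 2).const_mul c).const_add 1) hq
  refine h.congr_deriv ?_
  simp only [liouvilleKernelFlux, id, Pi.pow_apply]
  field_simp
  ring

lemma hasDerivAt_liouvilleKernel (hc : 0 < c) {r : ℝ} (hr : r ≠ 0) :
    HasDerivAt (liouvilleKernel c) (liouvilleKernelFlux c r / r) r :=
  (hasDerivAt_two_div hc hr).sub_const 1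

lemma hasDerivAt_liouvilleKernelFlux (hc : 0 < c) (r : ℝ) :
    HasDerivAt (liouvilleKernelFlux c)
      (-(r * (8 * c / (1 + c * r ^ 2) ^ 2) * liouvilleKernel c r)) r := by
  have hq : 1 + c * r ^ 2 ≠ 0 := by positivity
  have h := (((hasDerivAt_id r).pow 2).const_mul (4 * c)).neg.div
    (((((hasDerivAt_id r).pow 2).const_mul c).const_add 1).pow 2) (pow_ne_zero 2 hq)
  refine h.congr_deriv ?_
  simp only [liouvilleKernel, id, Pi.pow_apply, Pi.neg_apply]
  field_simp
  ring

lemma hasDerivAt_liouvilleLogKernel (hc : 0 < c) {r : ℝ} (hr : r ≠ 0) :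
    HasDerivAt (liouvilleLogKernel c) (liouvilleLogKernelFlux c r / r) r := by
  have h := ((hasDerivAt_liouvilleKernel hc hr).mul (hasDerivAt_log hr)).add
    (hasDerivAt_two_div hc hr)
  refine h.congr_deriv ?_
  simp only [liouvilleLogKernelFlux]
  field_simp
  ring

lemma hasDerivAt_liouvilleLogKernelFlux (hc : 0 < c) {r : ℝ} (hr : r ≠ 0) :
    HasDerivAt (liouvilleLogKernelFlux c)
      (-(r * (8 * c / (1 + c * r ^ 2) ^ 2) * liouvilleLogKernel c r)) r := by
  have hf := hasDerivAt_liouvilleKernelFlux hc r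
  have h := ((hasDerivAt_liouvilleKernel hc hr).add (hf.mul (hasDerivAt_log hr))).add hf
  refine h.congr_deriv ?_
  have hq : 1 + c * r ^ 2 ≠ 0 := by positivity
  simp only [liouvilleLogKernel, liouvilleKernel, liouvilleKernelFlux]
  field_simp
  ring

lemma continuous_liouvilleKernel (hc : 0 < c) : Continuous (liouvilleKernel c) := by
  unfold liouvilleKernel
  exact (continuous_const.div (by fun_prop) fun x => by positivity).sub continuous_const

lemma continuous_liouvilleKernelFlux (hc : 0 < c) : Continuous (liouvilleKernelFlux c) :=
  continuous_iff_continuousAt.2 fun r => (hasDerivAt_liouvilleKernelFlux hc r).continuousAt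

lemma continuous_mul_liouvilleLogKernel (hc : 0 < c) :
    Continuous fun r => r * liouvilleLogKernel c r := by
  have h : (fun r => r * liouvilleLogKernel c r) =
      fun r => liouvilleKernel c r * (r * log r) + r * (liouvilleKernel c r + 1) := by
    ext r
    simp only [liouvilleLogKernel, liouvilleKernel]
    ring
  rw [h]
  exact ((continuous_liouvilleKernel hc).mul continuous_mul_log).add
    (continuous_id.mul ((continuous_liouvilleKernel hc).add continuous_const))

lemma continuous_liouvilleLogKernelFlux (hc : 0 < c) :
    Continuous (liouvilleLogKernelFlux c) := by
  have h : liouvilleLogKernelFlux c = fun r => liouvilleKernel c r +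
      -(4 * c * r) / (1 + c * r ^ 2) ^ 2 * (r * log r) + liouvilleKernelFlux c r := by
    ext r
    simp only [liouvilleLogKernelFlux, liouvilleKernelFlux]
    ring
  rw [h]
  have hq : Continuous fun r : ℝ => -(4 * c * r) / (1 + c * r ^ 2) ^ 2 :=
    Continuous.div (by fun_prop) (by fun_prop) fun x => by positivity
  exact ((continuous_liouvilleKernel hc).add (hq.mul continuous_mul_log)).add
    (continuous_liouvilleKernelFlux hc)

lemma two_div_mem_Icc (hc : 0 < c) (r : ℝ) : 2 / (1 + c * r ^ 2) ∈ Set.Icc (0 : ℝ) 2 := by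
  refine ⟨by positivity, div_le_self (by norm_num) ?_⟩
  have : 0 ≤ c * r ^ 2 := by positivity
  linarith

lemma abs_liouvilleKernel_le_one (hc : 0 < c) (r : ℝ) : |liouvilleKernel c r| ≤ 1 := by
  have h := two_div_mem_Icc hc r
  exact abs_le.2 ⟨by unfold liouvilleKernel; linarith [h.1],
    by unfold liouvilleKernel; linarith [h.2]⟩

lemma mul_abs_log_le {r : ℝ} (hr : 0 < r) : r * |log r| ≤ r * log (1 + r) + 1 := by
  have hpos : 0 ≤ log (1 + r) := log_nonneg (by linarith)
  rcases le_total 1 r with h | h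
  · rw [abs_of_nonneg (log_nonneg h)]
    have : log r ≤ log (1 + r) := log_le_log hr (by linarith)
    nlinarith
  · rw [abs_of_nonpos (log_nonpos hr.le h)]
    have h1 := one_sub_inv_le_log_of_pos hr
    have h2 : r * (1 - r⁻¹) ≤ r * log r := mul_le_mul_of_nonneg_left h1 hr.le
    have h3 : r * (1 - r⁻¹) = r - 1 := by field_simp
    nlinarith

lemma mul_abs_liouvilleLogKernel_le (hc : 0 < c) {r : ℝ} (hr : 0 < r) :
    r * |liouvilleLogKernel c r| ≤ (1 + r) * (log (1 + r) + 3) := by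
  have hq := two_div_mem_Icc hc r
  have h1 : |liouvilleLogKernel c r| ≤ |log r| + 2 := by
    unfold liouvilleLogKernel
    refine (abs_add_le _ _).trans (add_le_add ?_ ?_)
    · rw [abs_mul]
      exact mul_le_of_le_one_left (abs_nonneg _) (abs_liouvilleKernel_le_one hc r)
    · rw [abs_of_nonneg hq.1]
      exact hq.2
  have h2 := mul_abs_log_le hr
  have hpos : 0 ≤ log (1 + r) := log_nonneg (by linarith)
  nlinarith [mul_le_mul_of_nonneg_left h1 hr.le]

/-- The normalized Wronskian of the two kernel elements is `1`. -/
lemma liouvilleKernel_wronskian (hc : 0 < c) (r : ℝ) :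
    liouvilleKernel c r * liouvilleLogKernelFlux c r -
      liouvilleLogKernel c r * liouvilleKernelFlux c r = 1 := by
  have hq : 1 + c * r ^ 2 ≠ 0 := by positivity
  simp only [liouvilleLogKernel, liouvilleLogKernelFlux, liouvilleKernel, liouvilleKernelFlux]
  field_simp
  ring

end Kernel

lemma hasDerivAt_sq_div {r : ℝ} (hr : 0 ≤ r) (ε : ℝ) :
    HasDerivAt (fun x => ε * (x ^ 2 / (2 * (1 + x) ^ 2))) (ε * (r / (1 + r) ^ 3)) r := by
  have h1 : 1 + r ≠ 0 := by positivity
  have h := ((((hasDerivAt_id r).pow 2).div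
    ((((hasDerivAt_id r).const_add 1).pow 2).const_mul 2) (by
      simp only [id, Pi.pow_apply]; positivity)).const_mul ε)
  refine h.congr_deriv ?_
  simp only [id, Pi.pow_apply]
  field_simp
  ring

lemma hasDerivAt_neg_log_add_div {r : ℝ} (hr : 0 ≤ r) (ε : ℝ) :
    HasDerivAt (fun x => ε * (-(log (1 + x) + 4) / (1 + x)))
      (ε * ((log (1 + r) + 3) / (1 + r) ^ 2)) r := by
  have h1 : 1 + r ≠ 0 := by positivity
  have h := (((((hasDerivAt_id r).const_add 1).log h1).add_const 4).neg.div
    ((hasDerivAt_id r).const_add 1) h1).const_mul ε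
  refine h.congr_deriv ?_
  simp only [id, Pi.neg_apply]
  field_simp
  ring

/-- The bound in terms of `d = g'` and `e = g''`, with an explicit constant. -/
lemma abs_le_of_radial_ode {c R ε : ℝ} (hc : 0 < c) (hε : 0 < ε) {g d e E : ℝ → ℝ}
    (hgc : ContinuousOn g (Set.Ico 0 R)) (hdc : ContinuousOn d (Set.Ico 0 R))
    (hg : ∀ r ∈ Set.Ioo 0 R, HasDerivAt g (d r) r)
    (hd : ∀ r ∈ Set.Ioo 0 R, HasDerivAt d (e r) r)
    (hg0 : g 0 = 0)
    (hode : ∀ r ∈ Set.Ioo 0 R,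
      e r + 1 / r * d r + 8 * c / (1 + c * r ^ 2) ^ 2 * g r = E r)
    (hE : ∀ r ∈ Set.Ioo 0 R, |E r| ≤ ε / (1 + r) ^ 3) {r : ℝ} (hr : r ∈ Set.Ioo 0 R) :
    |g r| ≤ ε * (log (1 + r) + 6) := by
  have hrIco : r ∈ Set.Ico 0 R := ⟨hr.1.le, hr.2⟩
  set W₁ : ℝ → ℝ := fun x => x * d x * liouvilleKernel c x - g x * liouvilleKernelFlux c x
    with hW₁
  set W₂ : ℝ → ℝ := fun x => x * d x * liouvilleLogKernel c x - g x * liouvilleLogKernelFlux c x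
    with hW₂
  have b₁ : |W₁ r| ≤ ε * (r ^ 2 / (2 * (1 + r) ^ 2)) := by
    have h := abs_le_sub_of_abs_deriv_le (W := W₁) (W' := fun x => x * liouvilleKernel c x * E x)
      (((continuousOn_id.mul hdc).mul (continuous_liouvilleKernel hc).continuousOn).sub
        (hgc.mul (continuous_liouvilleKernelFlux hc).continuousOn))
      (fun x hx => (hasDerivAt_sq_div hx.1 ε).continuousAt.continuousWithinAt)
      (fun x hx => hasDerivAt_radial_wronskian hx.1.ne' (hg x hx) (hd x hx) (hode x hx)
        (hasDerivAt_liouvilleKernel hc hx.1.ne') (hasDerivAt_liouvilleKernelFlux hc x))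
      (fun x hx => hasDerivAt_sq_div hx.1.le ε) (by simp [hW₁, hg0])
      (fun x hx => by
        have hx0 : 0 < x := hx.1
        rw [abs_mul, abs_mul, abs_of_pos hx0]
        calc x * |liouvilleKernel c x| * |E x| ≤ x * 1 * (ε / (1 + x) ^ 3) := by
              gcongr
              · exact abs_liouvilleKernel_le_one hc x
              · exact hE x hx
          _ = ε * (x / (1 + x) ^ 3) := by ring) hrIco
    simpa using h
  have b₂ : |W₂ r| ≤ ε * 4 := by
    have h := abs_le_sub_of_abs_deriv_le (W := W₂)
      (W' := fun x => x * liouvilleLogKernel c x * E x)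
      (((hdc.mul (continuous_mul_liouvilleLogKernel hc).continuousOn).sub
        (hgc.mul (continuous_liouvilleLogKernelFlux hc).continuousOn)).congr
          fun x _ => by simp only [hW₂, Pi.sub_apply, Pi.mul_apply]; ring)
      (fun x hx => (hasDerivAt_neg_log_add_div hx.1 ε).continuousAt.continuousWithinAt)
      (fun x hx => hasDerivAt_radial_wronskian hx.1.ne' (hg x hx) (hd x hx) (hode x hx)
        (hasDerivAt_liouvilleLogKernel hc hx.1.ne')
        (hasDerivAt_liouvilleLogKernelFlux hc hx.1.ne'))
      (fun x hx => hasDerivAt_neg_log_add_div hx.1.le ε) (by simp [hW₂, hg0])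
      (fun x hx => by
        have hx0 : 0 < x := hx.1
        have hlog : 0 ≤ log (1 + x) := log_nonneg (by linarith)
        rw [abs_mul, abs_mul, abs_of_pos hx0]
        calc x * |liouvilleLogKernel c x| * |E x|
            ≤ ((1 + x) * (log (1 + x) + 3)) * (ε / (1 + x) ^ 3) := by
              exact mul_le_mul (mul_abs_liouvilleLogKernel_le hc hx0) (hE x hx) (abs_nonneg _)
                (by positivity)
          _ = ε * ((log (1 + x) + 3) / (1 + x) ^ 2) := by field_simp) hrIco
    have hneg : -(log (1 + r) + 4) / (1 + r) ≤ 0 := by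
      have hlog : 0 ≤ log (1 + r) := log_nonneg (by linarith [hr.1])
      exact div_nonpos_of_nonpos_of_nonneg (by linarith) (by linarith [hr.1])
    have h0 : ε * (-(log (1 + 0) + 4) / (1 + 0)) = -(ε * 4) := by simp
    rw [h0] at h
    nlinarith
  have hrep : g r = W₁ r * liouvilleLogKernel c r - W₂ r * liouvilleKernel c r := by
    have hw := liouvilleKernel_wronskian hc r
    simp only [hW₁, hW₂]
    linear_combination (-g r) * hw
  have hr0 : 0 < r := hr.1
  have hlog : 0 ≤ log (1 + r) := log_nonneg (by linarith)
  have hr1 : r / (2 * (1 + r)) ≤ 1 / 2 := by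
    rw [div_le_div_iff₀ (by positivity) (by norm_num)]
    linarith
  have t₁ : |W₁ r| * |liouvilleLogKernel c r| ≤ ε * ((log (1 + r) + 3) / 2) := by
    calc |W₁ r| * |liouvilleLogKernel c r|
        ≤ ε * (r ^ 2 / (2 * (1 + r) ^ 2)) * |liouvilleLogKernel c r| := by gcongr
      _ = ε * (r / (2 * (1 + r) ^ 2)) * (r * |liouvilleLogKernel c r|) := by ring
      _ ≤ ε * (r / (2 * (1 + r) ^ 2)) * ((1 + r) * (log (1 + r) + 3)) := by
        exact mul_le_mul_of_nonneg_left (mul_abs_liouvilleLogKernel_le hc hr0) (by positivity)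
      _ = ε * (r / (2 * (1 + r)) * (log (1 + r) + 3)) := by field_simp
      _ ≤ ε * (1 / 2 * (log (1 + r) + 3)) := by gcongr
      _ = ε * ((log (1 + r) + 3) / 2) := by ring
  have t₂ : |W₂ r| * |liouvilleKernel c r| ≤ ε * 4 :=
    (mul_le_of_le_one_right (abs_nonneg _) (abs_liouvilleKernel_le_one hc r)).trans b₂
  calc |g r| ≤ |W₁ r| * |liouvilleLogKernel c r| + |W₂ r| * |liouvilleKernel c r| := by
        rw [hrep, ← abs_mul, ← abs_mul]
        exact abs_sub _ _
    _ ≤ ε * (log (1 + r) + 6) := by nlinarith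

/-- a priori logarithmic bound for solutions of the radial linearized
Liouville ODE with small right-hand side and vanishing initial data. -/
theorem radial_ode_log_bound (c₁ : ℝ) (hc : 0 < c₁) :
    ∃ C > (0 : ℝ), ∀ R : ℝ, 1 < R → ∀ ε : ℝ, 0 < ε → ∀ g E : ℝ → ℝ,
      ContDiffOn ℝ 2 g (Set.Ico 0 R) →
      g 0 = 0 →
      derivWithin g (Set.Ico 0 R) 0 = 0 →
      ContinuousOn E (Set.Ioo 0 R) →
      (∀ r : ℝ, 0 < r → r < R →
        derivWithin (derivWithin g (Set.Ico 0 R)) (Set.Ico 0 R) r +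
          1 / r * derivWithin g (Set.Ico 0 R) r +
          8 * c₁ / (1 + c₁ * r ^ 2) ^ 2 * g r = E r) →
      (∀ r : ℝ, 0 < r → r < R → |E r| ≤ ε * (1 + r) ^ (-3 : ℤ)) →
      ∀ r : ℝ, 0 ≤ r → r < R → |g r| ≤ C * ε * Real.log (2 + r) := by
  refine ⟨13, by norm_num, fun R hR ε hε g E hg hg0 _ _ hode hE r hr hrR => ?_⟩
  have hlog2 : 1 / 2 ≤ log (2 + r) :=
    (by linarith [log_two_gt_d9] : 1 / 2 ≤ log 2).trans (log_le_log (by norm_num) (by linarith))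
  rcases hr.eq_or_lt with rfl | hr0
  · rw [hg0, abs_zero]
    positivity
  have hu : UniqueDiffOn ℝ (Set.Ico (0 : ℝ) R) := uniqueDiffOn_Ico 0 R
  have hd : ContDiffOn ℝ 1 (derivWithin g (Set.Ico 0 R)) (Set.Ico 0 R) :=
    hg.derivWithin hu (by norm_num)
  have hasDeriv : ∀ f : ℝ → ℝ, DifferentiableOn ℝ f (Set.Ico 0 R) → ∀ x ∈ Set.Ioo 0 R,
      HasDerivAt f (derivWithin f (Set.Ico 0 R) x) x := fun f hf x hx =>
    (hf x ⟨hx.1.le, hx.2⟩).hasDerivWithinAt.hasDerivAt (Ico_mem_nhds hx.1 hx.2)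
  have key := abs_le_of_radial_ode hc hε hg.continuousOn hd.continuousOn
    (hasDeriv _ (hg.differentiableOn (by norm_num)))
    (hasDeriv _ (hd.differentiableOn (by norm_num))) hg0
    (fun x hx => hode x hx.1 hx.2)
    (fun x hx => by
      have h := hE x hx.1 hx.2
      rwa [zpow_neg, ← div_eq_mul_inv, show (3 : ℤ) = (3 : ℕ) from rfl, zpow_natCast] at h)
    ⟨hr0, hrR⟩
  have hmono : log (1 + r) ≤ log (2 + r) := log_le_log (by linarith) (by linarith)
  nlinarith
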